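/- Let ξ > 1 and assume additionally that b(x,y) ≥ b₀ > 0 on some nonempty open subset ω ⊂ Ω. Fix any η with 0 < η < (ξ−1)/(2L(1+2ξ)), set σ = ξ − 1 − 2Lη(1+2ξ) and κ = 1 + max{2ηL, σ/ξ}, and let θ be any number with 0 < θ < min{ 3αη/((1+2ηL)L²), σ/(2h(ξ+σ)) }. Then every classical solution ζ of the perturbed delayed ZK system with source f = 0 satisfies E_ξ(t) ≤ κ E_ξ(0) e^{−2θ t} for all t > 0. -/

import Mathlib

open MeasureTheory intervalIntegral Set

noncomputable section

/-- Partial derivative in time. -/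
def pT (ζ : ℝ → ℝ → ℝ → ℝ) (x y t : ℝ) : ℝ := deriv (fun τ => ζ x y τ) t
/-- Partial derivative in `x`. -/
def pX (ζ : ℝ → ℝ → ℝ → ℝ) (x y t : ℝ) : ℝ := deriv (fun s => ζ s y t) x
/-- Third partial derivative in `x`. -/
def pX3 (ζ : ℝ → ℝ → ℝ → ℝ) (x y t : ℝ) : ℝ := iteratedDeriv 3 (fun s => ζ s y t) x
/-- Partial derivative in `y`. -/
def pY (ζ : ℝ → ℝ → ℝ → ℝ) (x y t : ℝ) : ℝ := deriv (fun r => ζ x r t) y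
/-- Mixed derivative `∂ₓ∂ᵧ²`. -/
def pXYY (ζ : ℝ → ℝ → ℝ → ℝ) (x y t : ℝ) : ℝ :=
  deriv (fun s => iteratedDeriv 2 (fun r => ζ s r t) y) x

/-- Smoothness of a function of three real variables. -/
def Smooth3 (ζ : ℝ → ℝ → ℝ → ℝ) : Prop :=
  ContDiff ℝ (⊤ : ℕ∞) (fun p : ℝ × ℝ × ℝ => ζ p.1 p.2.1 p.2.2)

/-- Boundary conditions of the ZK-type systems on `Ω = (0,L)×(0,L)`. -/
def ZKbc (L : ℝ) (ζ : ℝ → ℝ → ℝ → ℝ) : Prop :=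
  ∀ t > (0:ℝ),
    (∀ y ∈ Ioo (0:ℝ) L,
      ζ 0 y t = 0 ∧ ζ L y t = 0 ∧ pX ζ L y t = 0 ∧ pY ζ L y t = 0) ∧
    (∀ x ∈ Ioo (0:ℝ) L, ζ x 0 t = 0 ∧ ζ x L t = 0)

/-- `M` is the essential supremum of `f` on `Ω = (0,L)×(0,L)`:
the greatest lower bound of the set of a.e. upper bounds. -/
def IsEssSupOn (L : ℝ) (f : ℝ → ℝ → ℝ) (M : ℝ) : Prop :=
  IsGLB {c : ℝ | ∀ᵐ p ∂(volume.restrict (Ioo (0:ℝ) L ×ˢ Ioo (0:ℝ) L)),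
    f p.1 p.2 ≤ c} M

/-- Bounded, nonnegative, measurable coefficient. -/
def Coeff (f : ℝ → ℝ → ℝ) : Prop :=
  Measurable (fun p : ℝ × ℝ => f p.1 p.2) ∧ (∀ x y, 0 ≤ f x y) ∧ ∃ M, ∀ x y, f x y ≤ M

/-- Squared `H`-norm of an initial state, with weight `w` on the delay component. -/
def Hn2 (L w : ℝ) (f : ℝ → ℝ → ℝ) (g : ℝ → ℝ → ℝ → ℝ) : ℝ :=
  (∫ x in (0:ℝ)..L, ∫ y in (0:ℝ)..L, (f x y)^2)
  + w * (∫ x in (0:ℝ)..L, ∫ y in (0:ℝ)..L, ∫ ρ in (0:ℝ)..1, (g x y ρ)^2)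

/-- `L²(Ω)` norm of `w(·,·,t)`. -/
def L2n (L : ℝ) (w : ℝ → ℝ → ℝ → ℝ) (t : ℝ) : ℝ :=
  Real.sqrt (∫ x in (0:ℝ)..L, ∫ y in (0:ℝ)..L, (w x y t)^2)

/-- Squared `H¹(Ω)` norm of `w(·,·,t)`. -/
def H1n2 (L : ℝ) (w : ℝ → ℝ → ℝ → ℝ) (t : ℝ) : ℝ :=
  ∫ x in (0:ℝ)..L, ∫ y in (0:ℝ)..L,
    ((w x y t)^2 + (pX w x y t)^2 + (pY w x y t)^2)

/-- Classical solution of the delayed ZK system. -/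
def IsZKSol (L α γ h : ℝ) (a b : ℝ → ℝ → ℝ) (ζ : ℝ → ℝ → ℝ → ℝ) : Prop :=
  Smooth3 ζ ∧ ZKbc L ζ ∧
  ∀ x ∈ Ioo (0:ℝ) L, ∀ y ∈ Ioo (0:ℝ) L, ∀ t > (0:ℝ),
    pT ζ x y t + α * pX3 ζ x y t + γ * pXYY ζ x y t + ζ x y t * pX ζ x y t
      + a x y * ζ x y t + b x y * ζ x y (t - h) = 0

/-- Energy of the delayed ZK system. -/
def zkE (L h : ℝ) (b : ℝ → ℝ → ℝ) (ζ : ℝ → ℝ → ℝ → ℝ) (t : ℝ) : ℝ :=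
  (1/2) * (∫ x in (0:ℝ)..L, ∫ y in (0:ℝ)..L, (ζ x y t)^2)
  + (h/2) * (∫ x in (0:ℝ)..L, ∫ y in (0:ℝ)..L, ∫ ρ in (0:ℝ)..1,
      b x y * (ζ x y (t - ρ*h))^2)

/-- Classical solution of the (nonlinear) μ-system. -/
def IsMuSol (L α γ h μ₁ μ₂ : ℝ) (a : ℝ → ℝ → ℝ) (ζ : ℝ → ℝ → ℝ → ℝ) : Prop :=
  Smooth3 ζ ∧ ZKbc L ζ ∧
  ∀ x ∈ Ioo (0:ℝ) L, ∀ y ∈ Ioo (0:ℝ) L, ∀ t > (0:ℝ),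
    pT ζ x y t + α * pX3 ζ x y t + γ * pXYY ζ x y t + ζ x y t * pX ζ x y t
      + a x y * (μ₁ * ζ x y t + μ₂ * ζ x y (t - h)) = 0

/-- Classical solution of the linear μ-system with source `f`. -/
def IsLinMuSolF (L α γ h μ₁ μ₂ : ℝ) (a : ℝ → ℝ → ℝ) (f : ℝ → ℝ → ℝ → ℝ)
    (ζ : ℝ → ℝ → ℝ → ℝ) : Prop :=
  Smooth3 ζ ∧ ZKbc L ζ ∧
  ∀ x ∈ Ioo (0:ℝ) L, ∀ y ∈ Ioo (0:ℝ) L, ∀ t > (0:ℝ),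
    pT ζ x y t + α * pX3 ζ x y t + γ * pXYY ζ x y t
      + a x y * (μ₁ * ζ x y t + μ₂ * ζ x y (t - h)) = f x y t

/-- Classical solution of the linear μ-system. -/
def IsLinMuSol (L α γ h μ₁ μ₂ : ℝ) (a : ℝ → ℝ → ℝ) (ζ : ℝ → ℝ → ℝ → ℝ) : Prop :=
  IsLinMuSolF L α γ h μ₁ μ₂ a (fun _ _ _ => 0) ζ

/-- Energy of the μ-system. -/
def muE (L h ξ : ℝ) (a : ℝ → ℝ → ℝ) (ζ : ℝ → ℝ → ℝ → ℝ) (t : ℝ) : ℝ :=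
  (1/2) * (∫ x in (0:ℝ)..L, ∫ y in (0:ℝ)..L, (ζ x y t)^2)
  + (ξ/2) * (∫ x in (0:ℝ)..L, ∫ y in (0:ℝ)..L, ∫ ρ in (0:ℝ)..1,
      a x y * (ζ x y (t - ρ*h))^2)

/-- Classical solution of the perturbed delayed ZK system with source `f`. -/
def IsPertSol (L α γ h ξ : ℝ) (a b : ℝ → ℝ → ℝ) (f : ℝ → ℝ → ℝ → ℝ)
    (ζ : ℝ → ℝ → ℝ → ℝ) : Prop :=
  Smooth3 ζ ∧ ZKbc L ζ ∧
  ∀ x ∈ Ioo (0:ℝ) L, ∀ y ∈ Ioo (0:ℝ) L, ∀ t > (0:ℝ),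
    pT ζ x y t + α * pX3 ζ x y t + γ * pXYY ζ x y t
      + a x y * ζ x y t + b x y * (ξ * ζ x y t + ζ x y (t - h)) = f x y t

/-- Energy `E_ξ` of the perturbed delayed ZK system. -/
def pertE (L h ξ : ℝ) (b : ℝ → ℝ → ℝ) (ζ : ℝ → ℝ → ℝ → ℝ) (t : ℝ) : ℝ :=
  (1/2) * (∫ x in (0:ℝ)..L, ∫ y in (0:ℝ)..L, (ζ x y t)^2)
  + (ξ*h/2) * (∫ x in (0:ℝ)..L, ∫ y in (0:ℝ)..L, ∫ ρ in (0:ℝ)..1,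
      b x y * (ζ x y (t - ρ*h))^2)

/-- Differentiation under the integral sign over a relatively compact set, with a bounded
measurable weight. -/
theorem hasDerivAt_setIntegral_weighted {X : Type*} [TopologicalSpace X] [MeasurableSpace X]
    [OpensMeasurableSpace X] {μ : Measure X} [IsFiniteMeasureOnCompacts μ] {K s : Set X}
    (hK : IsCompact K) (hs : MeasurableSet s) (hsK : s ⊆ K) {c : X → ℝ} (hc : Measurable c) {C : ℝ}
    (hC : ∀ x, |c x| ≤ C) {F F' : X → ℝ → ℝ} (hF : Continuous (fun p : X × ℝ => F p.1 p.2))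
    (hF' : Continuous (fun p : X × ℝ => F' p.1 p.2))
    (hd : ∀ x t, HasDerivAt (F x) (F' x t) t) (t : ℝ) :
    HasDerivAt (fun τ => ∫ x in s, c x * F x τ ∂μ) (∫ x in s, c x * F' x t ∂μ) t := by
  have hfin : μ s < ⊤ := (measure_mono hsK).trans_lt hK.measure_lt_top
  have hFt : ∀ τ, Measurable (fun x => F x τ) := fun τ =>
    (hF.comp (Continuous.prodMk continuous_id continuous_const)).measurable
  have hFt' : ∀ τ, Measurable (fun x => F' x τ) := fun τ =>
    (hF'.comp (Continuous.prodMk continuous_id continuous_const)).measurable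
  obtain ⟨M, hM⟩ := (hK.prod (isCompact_Icc (a := t - 1) (b := t + 1))).exists_bound_of_continuousOn
    hF.continuousOn
  obtain ⟨M', hM'⟩ :=
    (hK.prod (isCompact_Icc (a := t - 1) (b := t + 1))).exists_bound_of_continuousOn
      hF'.continuousOn
  have key : ∀ {G : X → ℝ → ℝ} {N : ℝ},
      (∀ p ∈ K ×ˢ Icc (t - 1) (t + 1), ‖G p.1 p.2‖ ≤ N) →
      ∀ x ∈ s, ∀ τ ∈ Icc (t - 1) (t + 1), ‖c x * G x τ‖ ≤ C * N := by
    intro G N hN x hx τ hτ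
    rw [norm_mul]
    exact mul_le_mul (hC x) (hN (x, τ) ⟨hsK hx, hτ⟩) (norm_nonneg _) ((abs_nonneg _).trans (hC x))
  have ht : t ∈ Icc (t - 1) (t + 1) := ⟨by linarith, by linarith⟩
  refine (hasDerivAt_integral_of_dominated_loc_of_deriv_le (μ := μ.restrict s)
    (F := fun τ x => c x * F x τ) (F' := fun τ x => c x * F' x τ) (bound := fun _ => C * M')
    (Icc_mem_nhds (a := t - 1) (b := t + 1) (by linarith) (by linarith))
    ?_ ?_ ?_ ?_ ?_ ?_).2
  · exact Filter.Eventually.of_forall fun τ => (hc.mul (hFt τ)).aestronglyMeasurable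
  · refine Measure.integrableOn_of_bounded (M := C * M) hfin.ne
      (hc.mul (hFt t)).aestronglyMeasurable ?_
    exact (ae_restrict_iff' hs).2 (Filter.Eventually.of_forall fun x hx => key hM x hx t ht)
  · exact (hc.mul (hFt' t)).aestronglyMeasurable
  · exact (ae_restrict_iff' hs).2 (Filter.Eventually.of_forall fun x hx τ hτ => key hM' x hx τ hτ)
  · exact integrableOn_const hfin.ne
  · exact Filter.Eventually.of_forall fun x τ _ => (hd x τ).const_mul (c x)

/-- The directional derivative of a real function along a fixed vector. -/
def dirDeriv {E : Type*} [NormedAddCommGroup E] [NormedSpace ℝ E] (v : E) (F : E → ℝ) (p : E) : ℝ :=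
  fderiv ℝ F p v

section DirDeriv

variable {E : Type*} [NormedAddCommGroup E] [NormedSpace ℝ E]

theorem ContDiff.dirDeriv {F : E → ℝ} (hF : ContDiff ℝ (⊤ : ℕ∞) F) (v : E) :
    ContDiff ℝ (⊤ : ℕ∞) (dirDeriv v F) :=
  (hF.fderiv_right (m := (⊤ : ℕ∞)) (by norm_cast)).clm_apply contDiff_const

theorem dirDeriv_comm {F : E → ℝ} (hF : ContDiff ℝ (⊤ : ℕ∞) F) (v w : E) :
    dirDeriv v (dirDeriv w F) = dirDeriv w (dirDeriv v F) := by
  have hd : Differentiable ℝ (fderiv ℝ F) :=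
    (hF.fderiv_right (m := (⊤ : ℕ∞)) (by norm_cast)).differentiable (by simp)
  have h : ∀ v w p, dirDeriv v (dirDeriv w F) p = fderiv ℝ (fderiv ℝ F) p v w := by
    intro v w p
    have := ((hd p).hasFDerivAt.clm_apply (hasFDerivAt_const w p)).fderiv
    unfold _root_.dirDeriv
    rw [this]
    simp
  funext p
  rw [h, h]
  exact ((hF.contDiffAt (x := p)).isSymmSndFDerivAt (by simp; norm_cast)).eq v w

theorem hasDerivAt_comp_dirDeriv {F : E → ℝ} (hF : ContDiff ℝ (⊤ : ℕ∞) F) {c : ℝ → E} {v : E} {s : ℝ}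
    (hc : HasDerivAt c v s) : HasDerivAt (fun r => F (c r)) (dirDeriv v F (c s)) s :=
  ((hF.differentiable (by simp)) (c s)).hasFDerivAt.comp_hasDerivAt s hc

end DirDeriv

theorem hasDerivAt_slice_fst {F : ℝ × ℝ × ℝ → ℝ} (hF : ContDiff ℝ (⊤ : ℕ∞) F) (x y t : ℝ) :
    HasDerivAt (fun s => F (s, y, t)) (dirDeriv (1, 0, 0) F (x, y, t)) x :=
  hasDerivAt_comp_dirDeriv hF ((hasDerivAt_id x).prodMk (hasDerivAt_const x (y, t)))

theorem hasDerivAt_slice_snd {F : ℝ × ℝ × ℝ → ℝ} (hF : ContDiff ℝ (⊤ : ℕ∞) F) (x y t : ℝ) :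
    HasDerivAt (fun s => F (x, s, t)) (dirDeriv (0, 1, 0) F (x, y, t)) y :=
  hasDerivAt_comp_dirDeriv hF
    ((hasDerivAt_const y x).prodMk ((hasDerivAt_id y).prodMk (hasDerivAt_const y t)))

theorem hasDerivAt_slice_thd {F : ℝ × ℝ × ℝ → ℝ} (hF : ContDiff ℝ (⊤ : ℕ∞) F) (x y t : ℝ) :
    HasDerivAt (fun s => F (x, y, s)) (dirDeriv (0, 0, 1) F (x, y, t)) t :=
  hasDerivAt_comp_dirDeriv hF
    ((hasDerivAt_const t x).prodMk ((hasDerivAt_const t y).prodMk (hasDerivAt_id t)))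

/-- Weighted one-dimensional dissipation estimate for `∂ₓ³`. -/
theorem weighted_third_deriv_nonneg {L η : ℝ} (hL : 0 < L) (hη : 0 ≤ η) {φ φ₁ φ₂ φ₃ : ℝ → ℝ}
    (h₁ : ∀ x, HasDerivAt φ (φ₁ x) x) (h₂ : ∀ x, HasDerivAt φ₁ (φ₂ x) x)
    (h₃ : ∀ x, HasDerivAt φ₂ (φ₃ x) x) (hc : Continuous φ₃)
    (h0 : φ 0 = 0) (hφL : φ L = 0) (hφ₁L : φ₁ L = 0) :
    0 ≤ ∫ x in (0:ℝ)..L, ((1 + 2*η*x) * φ x * φ₃ x - 3*η/L^2 * φ x ^ 2) := by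
  have c0 : Continuous φ := continuous_iff_continuousAt.2 fun x => (h₁ x).continuousAt
  have c1 : Continuous φ₁ := continuous_iff_continuousAt.2 fun x => (h₂ x).continuousAt
  have c2 : Continuous φ₂ := continuous_iff_continuousAt.2 fun x => (h₃ x).continuousAt
  set P : ℝ → ℝ := fun x => (1 + 2*η*x) * φ x * φ₂ x - 1/2 * ((1 + 2*η*x) * φ₁ x ^ 2)
    - 2*η*(φ x * φ₁ x) - 6*η/L^2 * ((x - L/2) * φ x ^ 2) with hP
  set P' : ℝ → ℝ := fun x => (1 + 2*η*x) * φ x * φ₃ x - 3*η*φ₁ x ^ 2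
    - 6*η/L^2 * (φ x ^ 2 + 2 * (x - L/2) * φ x * φ₁ x) with hP'
  have hd : ∀ x, HasDerivAt P (P' x) x := by
    intro x
    have hq : HasDerivAt (fun x : ℝ => 1 + 2*η*x) (2*η) x := by
      simpa using ((hasDerivAt_id x).const_mul (2*η)).const_add 1
    have hr : HasDerivAt (fun x : ℝ => x - L/2) 1 x := (hasDerivAt_id x).sub_const _
    refine (((hq.mul (h₁ x)).mul (h₃ x)).sub ((hq.mul ((h₂ x).pow 2)).const_mul (1/2))
      |>.sub (((h₁ x).mul (h₂ x)).const_mul (2*η))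
      |>.sub ((hr.mul ((h₁ x).pow 2)).const_mul (6*η/L^2))).congr_deriv ?_
    simp only [hP', Pi.mul_apply, Pi.pow_apply]
    push_cast
    ring
  have hcP' : Continuous P' := by fun_prop
  have hint : ∫ x in (0:ℝ)..L, P' x = P L - P 0 :=
    intervalIntegral.integral_eq_sub_of_hasDerivAt (fun x _ => hd x) (hcP'.intervalIntegrable _ _)
  have hval : 0 ≤ P L - P 0 := by
    simp only [hP, h0, hφL, hφ₁L]
    nlinarith [sq_nonneg (φ₁ 0)]
  rw [← hint] at hval
  refine hval.trans (intervalIntegral.integral_mono_on hL.le (hcP'.intervalIntegrable _ _)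
    (Continuous.intervalIntegrable (by fun_prop) _ _) fun x hx => ?_)
  have hx' : (x - L/2)^2 ≤ (L/2)^2 := by nlinarith [hx.1, hx.2]
  have hk : φ x ^ 2 - L^2 * φ₁ x ^ 2 ≤ 2 * (φ x ^ 2 + 2 * (x - L/2) * φ x * φ₁ x) := by
    nlinarith [sq_nonneg (φ x + 2 * (x - L/2) * φ₁ x),
      mul_le_mul_of_nonneg_right hx' (sq_nonneg (φ₁ x))]
  have hk' := mul_le_mul_of_nonneg_left hk (show 0 ≤ 3*η/L^2 by positivity)
  have e : 3*η/L^2 * (φ x ^ 2 - L^2 * φ₁ x ^ 2) = 3*η/L^2 * φ x ^ 2 - 3*η*φ₁ x ^ 2 := by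
    field_simp
  rw [e] at hk'
  simp only [hP']
  linear_combination hk'

/-- Time derivative of the weighted memory term. -/
theorem hasDerivAt_memory {h ξ σ : ℝ} {φ φ' : ℝ → ℝ}
    (hd : ∀ t, HasDerivAt φ (φ' t) t) (hc : Continuous φ') (t : ℝ) :
    HasDerivAt (fun τ => ∫ ρ in (0:ℝ)..1, h/2*(ξ + σ*(1 - ρ)) * φ (τ - ρ*h) ^ 2)
      (1/2*(ξ+σ) * φ t ^ 2 - 1/2*ξ * φ (t - h) ^ 2
        - σ/2 * ∫ ρ in (0:ℝ)..1, φ (t - ρ*h) ^ 2) t := by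
  have c0 : Continuous φ := continuous_iff_continuousAt.2 fun x => (hd x).continuousAt
  have key := hasDerivAt_setIntegral_weighted (μ := volume) (isCompact_Icc (a := (0:ℝ)) (b := 1))
    measurableSet_Ioc Ioc_subset_Icc_self (c := fun _ => 1) measurable_const (C := 1) (by simp)
    (F := fun ρ τ => h/2*(ξ + σ*(1 - ρ)) * φ (τ - ρ*h) ^ 2)
    (F' := fun ρ τ => h/2*(ξ + σ*(1 - ρ)) * (2 * φ (τ - ρ*h) * φ' (τ - ρ*h)))
    (by fun_prop) (by fun_prop) (fun ρ τ => by
      have := ((hd (τ - ρ*h)).comp τ ((hasDerivAt_id τ).sub_const (ρ*h))).pow 2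
      simpa [mul_assoc] using this.const_mul (h/2*(ξ + σ*(1 - ρ)))) t
  simp only [one_mul, ← intervalIntegral.integral_of_le (zero_le_one (α := ℝ))] at key
  convert key using 1
  have hparts : ∀ ρ, HasDerivAt (fun ρ => -(1/2)*(ξ + σ*(1 - ρ)) * φ (t - ρ*h) ^ 2)
      (h/2*(ξ + σ*(1 - ρ)) * (2 * φ (t - ρ*h) * φ' (t - ρ*h)) + σ/2 * φ (t - ρ*h) ^ 2) ρ := by
    intro ρ
    have h1 : HasDerivAt (fun ρ : ℝ => t - ρ*h) (-h) ρ := by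
      simpa using ((hasDerivAt_id ρ).mul_const h).const_sub t
    have h2 : HasDerivAt (fun ρ : ℝ => -(1/2)*(ξ + σ*(1 - ρ))) (σ/2) ρ := by
      have := ((((hasDerivAt_id ρ).const_sub 1).const_mul σ).const_add ξ).const_mul (-(1/2))
      exact this.congr_deriv (by ring)
    have h3 := ((hd (t - ρ*h)).comp ρ h1).pow 2
    refine (h2.mul h3).congr_deriv ?_
    simp only [Function.comp_apply, Pi.pow_apply]
    push_cast
    ring
  have hI := intervalIntegral.integral_eq_sub_of_hasDerivAt (a := 0) (b := 1)
    (fun ρ _ => hparts ρ) (Continuous.intervalIntegrable (by fun_prop) _ _)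
  rw [intervalIntegral.integral_add (Continuous.intervalIntegrable (by fun_prop) _ _)
    (Continuous.intervalIntegrable (by fun_prop) _ _), intervalIntegral.integral_const_mul] at hI
  simp only [zero_mul, sub_zero, one_mul] at hI
  linear_combination -hI

section Square

variable {L : ℝ}

theorem integrableOn_square_mul {c : ℝ × ℝ → ℝ} (hc : Measurable c) {C : ℝ} (hC : ∀ p, |c p| ≤ C)
    {f : ℝ × ℝ → ℝ} (hf : Continuous f) :
    IntegrableOn (fun p => c p * f p) (Ioo (0:ℝ) L ×ˢ Ioo (0:ℝ) L) := by
  have hf' : IntegrableOn f (Ioo (0:ℝ) L ×ˢ Ioo (0:ℝ) L) :=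
    (hf.continuousOn.integrableOn_compact (isCompact_Icc.prod isCompact_Icc)).mono_set
      (prod_mono Ioo_subset_Icc_self Ioo_subset_Icc_self)
  exact hf'.bdd_mul hc.aestronglyMeasurable (Filter.Eventually.of_forall hC)

theorem integrableOn_square {f : ℝ × ℝ → ℝ} (hf : Continuous f) :
    IntegrableOn f (Ioo (0:ℝ) L ×ˢ Ioo (0:ℝ) L) := by
  simpa using integrableOn_square_mul (L := L) (c := fun _ => 1) measurable_const (C := 1)
    (by simp) hf

theorem setIntegral_square_eq (hL : 0 ≤ L) {f : ℝ × ℝ → ℝ}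
    (hf : IntegrableOn f (Ioo (0:ℝ) L ×ˢ Ioo (0:ℝ) L)) :
    ∫ p in Ioo (0:ℝ) L ×ˢ Ioo (0:ℝ) L, f p = ∫ x in (0:ℝ)..L, ∫ y in (0:ℝ)..L, f (x, y) := by
  simp only [intervalIntegral.integral_of_le hL, integral_Ioc_eq_integral_Ioo]
  exact setIntegral_prod f hf

theorem setIntegral_square_eq_fst_slices (hL : 0 ≤ L) {f : ℝ × ℝ → ℝ} (hf : Continuous f) :
    ∫ p in Ioo (0:ℝ) L ×ˢ Ioo (0:ℝ) L, f p = ∫ y in Ioo (0:ℝ) L, ∫ x in (0:ℝ)..L, f (x, y) := by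
  simp only [intervalIntegral.integral_of_le hL, integral_Ioc_eq_integral_Ioo]
  exact (setIntegral_prod_swap (μ := volume) (ν := volume) (Ioo (0:ℝ) L) (Ioo (0:ℝ) L) f).symm.trans
    (setIntegral_prod (fun q : ℝ × ℝ => f q.swap)
      (integrableOn_square (hf.comp continuous_swap)))

end Square

/-- The mixed dispersive term is dissipative for the weight `1 + 2ηx`. -/
theorem weighted_mixed_deriv_nonneg {L η : ℝ} (hL : 0 < L) (hη : 0 ≤ η) {u : ℝ × ℝ × ℝ → ℝ}
    (hu : ContDiff ℝ (⊤ : ℕ∞) u) (t : ℝ)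
    (hx : ∀ x ∈ Ioo (0:ℝ) L, u (x, 0, t) = 0 ∧ u (x, L, t) = 0)
    (hy : ∀ y ∈ Ioo (0:ℝ) L, u (0, y, t) = 0 ∧ u (L, y, t) = 0) :
    0 ≤ ∫ p in Ioo (0:ℝ) L ×ˢ Ioo (0:ℝ) L, (1 + 2*η*p.1) * u (p.1, p.2, t) *
      dirDeriv (1, 0, 0) (dirDeriv (0, 1, 0) (dirDeriv (0, 1, 0) u)) (p.1, p.2, t) := by
  set uy := dirDeriv (0, 1, 0) u with huy
  set uxy := dirDeriv (1, 0, 0) uy with huxy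
  set uxyy := dirDeriv (1, 0, 0) (dirDeriv (0, 1, 0) uy) with huxyy
  have sy : ContDiff ℝ (⊤ : ℕ∞) uy := hu.dirDeriv _
  have sxy : ContDiff ℝ (⊤ : ℕ∞) uxy := sy.dirDeriv _
  have hcomm : uxyy = dirDeriv (0, 1, 0) uxy := dirDeriv_comm sy _ _
  have sxyy : ContDiff ℝ (⊤ : ℕ∞) uxyy := (sy.dirDeriv _).dirDeriv _
  have c0 := hu.continuous
  have cy := sy.continuous
  have cxy := sxy.continuous
  have cxyy := sxyy.continuous
  set A : ℝ × ℝ → ℝ := fun p => (1 + 2*η*p.1) *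
    (uy (p.1, p.2, t) * uxy (p.1, p.2, t) + u (p.1, p.2, t) * uxyy (p.1, p.2, t)) with hA
  set B : ℝ × ℝ → ℝ := fun p => 2*η * uy (p.1, p.2, t) ^ 2 +
    (1 + 2*η*p.1) * (2 * uy (p.1, p.2, t) * uxy (p.1, p.2, t)) with hB
  have cA : Continuous A := by fun_prop
  have cB : Continuous B := by fun_prop
  have hIA : ∫ p in Ioo (0:ℝ) L ×ˢ Ioo (0:ℝ) L, A p = 0 := by
    rw [setIntegral_square_eq hL.le (integrableOn_square cA),
      intervalIntegral.integral_of_le hL.le, integral_Ioc_eq_integral_Ioo]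
    refine setIntegral_eq_zero_of_forall_eq_zero fun x hx' => ?_
    have := intervalIntegral.integral_eq_sub_of_hasDerivAt (a := 0) (b := L)
      (f := fun y => (1 + 2*η*x) * (u (x, y, t) * uxy (x, y, t))) (f' := fun y => A (x, y))
      (fun y _ => by
        have := ((hasDerivAt_slice_snd hu x y t).mul
          (hasDerivAt_slice_snd sxy x y t)).const_mul (1 + 2*η*x)
        rw [← hcomm] at this
        exact this)
      (Continuous.intervalIntegrable (by fun_prop) _ _)
    rw [this, (hx x hx').1, (hx x hx').2]
    ring
  have hIB : ∫ p in Ioo (0:ℝ) L ×ˢ Ioo (0:ℝ) L, B p = 0 := by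
    rw [setIntegral_square_eq_fst_slices hL.le cB]
    refine setIntegral_eq_zero_of_forall_eq_zero fun y hy' => ?_
    have := intervalIntegral.integral_eq_sub_of_hasDerivAt (a := 0) (b := L)
      (f := fun x => (1 + 2*η*x) * uy (x, y, t) ^ 2) (f' := fun x => B (x, y))
      (fun x _ => by
        have hq : HasDerivAt (fun x : ℝ => 1 + 2*η*x) (2*η) x := by
          simpa using ((hasDerivAt_id x).const_mul (2*η)).const_add 1
        refine (hq.mul ((hasDerivAt_slice_fst sy x y t).pow 2)).congr_deriv ?_
        simp only [hB, Pi.pow_apply]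
        push_cast
        ring)
      (Continuous.intervalIntegrable (by fun_prop) _ _)
    have hz : ∀ x, (∀ y ∈ Ioo (0:ℝ) L, u (x, y, t) = 0) → uy (x, y, t) = 0 := fun x h =>
      (hasDerivAt_slice_snd hu x y t).unique ((hasDerivAt_const y (0:ℝ)).congr_of_eventuallyEq
        (Filter.eventually_of_mem (isOpen_Ioo.mem_nhds hy') h))
    rw [this, hz 0 fun y h => (hy y h).1, hz L fun y h => (hy y h).2]
    ring
  have hIC : 0 ≤ ∫ p in Ioo (0:ℝ) L ×ˢ Ioo (0:ℝ) L, η * uy (p.1, p.2, t) ^ 2 :=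
    setIntegral_nonneg (measurableSet_Ioo.prod measurableSet_Ioo) fun p _ => by positivity
  have e : ∀ p : ℝ × ℝ, (1 + 2*η*p.1) * u (p.1, p.2, t) * uxyy (p.1, p.2, t) =
      (A p - 1/2 * B p) + η * uy (p.1, p.2, t) ^ 2 := fun p => by
    simp only [hA, hB]; ring
  simp_rw [e]
  rw [MeasureTheory.integral_add (integrableOn_square (by fun_prop)) (integrableOn_square (by fun_prop)),
    MeasureTheory.integral_sub (integrableOn_square cA) (integrableOn_square (by fun_prop)),
    MeasureTheory.integral_const_mul, hIA, hIB]
  simpa using hIC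


theorem pT_eq {ζ : ℝ → ℝ → ℝ → ℝ} (hζ : Smooth3 ζ) (x y t : ℝ) :
    pT ζ x y t = dirDeriv (0, 0, 1) (fun p : ℝ × ℝ × ℝ => ζ p.1 p.2.1 p.2.2) (x, y, t) :=
  (hasDerivAt_slice_thd hζ x y t).deriv

theorem pX_eq {ζ : ℝ → ℝ → ℝ → ℝ} (hζ : Smooth3 ζ) (x y t : ℝ) :
    pX ζ x y t = dirDeriv (1, 0, 0) (fun p : ℝ × ℝ × ℝ => ζ p.1 p.2.1 p.2.2) (x, y, t) :=
  (hasDerivAt_slice_fst hζ x y t).deriv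

theorem pX3_eq {ζ : ℝ → ℝ → ℝ → ℝ} (hζ : Smooth3 ζ) (x y t : ℝ) :
    pX3 ζ x y t = dirDeriv (1, 0, 0) (dirDeriv (1, 0, 0) (dirDeriv (1, 0, 0)
      (fun p : ℝ × ℝ × ℝ => ζ p.1 p.2.1 p.2.2))) (x, y, t) := by
  have e1 := funext fun s => (hasDerivAt_slice_fst hζ s y t).deriv
  have e2 := funext fun s => (hasDerivAt_slice_fst (hζ.dirDeriv (1, 0, 0)) s y t).deriv
  simp only at e1
  rw [pX3, iteratedDeriv_succ, iteratedDeriv_succ, iteratedDeriv_one, e1, e2]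
  exact (hasDerivAt_slice_fst ((hζ.dirDeriv _).dirDeriv _) x y t).deriv

theorem pXYY_eq {ζ : ℝ → ℝ → ℝ → ℝ} (hζ : Smooth3 ζ) (x y t : ℝ) :
    pXYY ζ x y t = dirDeriv (1, 0, 0) (dirDeriv (0, 1, 0) (dirDeriv (0, 1, 0)
      (fun p : ℝ × ℝ × ℝ => ζ p.1 p.2.1 p.2.2))) (x, y, t) := by
  have e1 := fun s => funext fun r => (hasDerivAt_slice_snd hζ s r t).deriv
  simp only at e1
  have e2 : ∀ s, iteratedDeriv 2 (fun r => ζ s r t) y = dirDeriv (0, 1, 0) (dirDeriv (0, 1, 0)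
      (fun p : ℝ × ℝ × ℝ => ζ p.1 p.2.1 p.2.2)) (s, y, t) := fun s => by
    rw [iteratedDeriv_succ, iteratedDeriv_one, e1 s]
    exact (hasDerivAt_slice_snd (hζ.dirDeriv _) s y t).deriv
  simp only [pXYY, e2]
  exact (hasDerivAt_slice_fst ((hζ.dirDeriv _).dirDeriv _) x y t).deriv

/-- The memory term with weight `h/2 (ξ + σ(1-ρ))` is comparable to the unweighted one. -/
theorem memory_bounds {h ξ σ : ℝ} (hh : 0 ≤ h) (hσ : 0 ≤ σ) {φ : ℝ → ℝ} (hφ : Continuous φ) :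
    ξ*h/2 * (∫ ρ in (0:ℝ)..1, φ ρ ^ 2) ≤ ∫ ρ in (0:ℝ)..1, h/2*(ξ + σ*(1 - ρ)) * φ ρ ^ 2 ∧
    ∫ ρ in (0:ℝ)..1, h/2*(ξ + σ*(1 - ρ)) * φ ρ ^ 2 ≤ h/2*(ξ+σ) * ∫ ρ in (0:ℝ)..1, φ ρ ^ 2 := by
  simp only [← intervalIntegral.integral_const_mul]
  constructor <;>
    refine intervalIntegral.integral_mono_on zero_le_one
      (Continuous.intervalIntegrable (by fun_prop) _ _)
      (Continuous.intervalIntegrable (by fun_prop) _ _) fun ρ hρ =>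
      mul_le_mul_of_nonneg_right ?_ (sq_nonneg _)
  · nlinarith [mul_nonneg hh (mul_nonneg hσ (sub_nonneg.2 hρ.2))]
  · nlinarith [mul_nonneg hh (mul_nonneg hσ hρ.1)]

/-- Pointwise dissipation inequality for the Lyapunov density. -/
theorem lyapunov_density_le {L α γ h ξ η σ θ q a b u v w u₃ uₘ uₜ J : ℝ}
    (ha : 0 ≤ a) (hb : 0 ≤ b) (hξ : 0 ≤ ξ) (hθ : 0 ≤ θ) (hJ : 0 ≤ J)
    (hLη : 0 ≤ L*η) (hσ₀ : 0 ≤ σ) (hσ : σ = ξ - 1 - 2*L*η*(1+2*ξ))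
    (hq₁ : 1 ≤ q) (hq₂ : q ≤ 1 + 2*η*L)
    (hθ₁ : θ*(1 + 2*η*L) ≤ α*(3*η/L^2)) (hθ₂ : θ*(h*(ξ+σ)) ≤ σ/2)
    (hw : w ≤ h/2*(ξ+σ)*J)
    (hpde : uₜ + α*u₃ + γ*uₘ + a*u + b*(ξ*u + v) = 0) :
    q*u*uₜ + b*(1/2*(ξ+σ)*u^2 - 1/2*ξ*v^2 - σ/2*J) + 2*θ*(1/2*q*u^2 + b*w)
      ≤ -α*(q*u*u₃ - 3*η/L^2*u^2) - γ*(q*u*uₘ) := by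
  have s1 : 0 ≤ q*a*u^2 := by positivity
  have hquv : -(q*(u*v)) ≤ (1 + 2*η*L)*(1/2*(u^2 + v^2)) := by
    have h1 : -(u*v) ≤ 1/2*(u^2 + v^2) := by nlinarith [sq_nonneg (u+v)]
    have h2 : 0 ≤ 1/2*(u^2 + v^2) := by positivity
    nlinarith [mul_le_mul_of_nonneg_left h1 (zero_le_one.trans hq₁),
      mul_le_mul_of_nonneg_right hq₂ h2]
  have hquu : ξ*u^2 ≤ q*(ξ*u^2) := le_mul_of_one_le_left (by positivity) hq₁
  have s2 : b*(1/2*(ξ+σ)*u^2 - 1/2*ξ*v^2 - q*(ξ*u^2) - q*(u*v)) ≤ 0 := by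
    refine mul_nonpos_of_nonneg_of_nonpos hb ?_
    have k1 : 0 ≤ (L*η*ξ)*u^2 := mul_nonneg (mul_nonneg hLη hξ) (sq_nonneg _)
    have k2 : 0 ≤ (σ + 4*(L*η*ξ))*v^2 :=
      mul_nonneg (add_nonneg hσ₀ (mul_nonneg (by norm_num) (mul_nonneg hLη hξ))) (sq_nonneg _)
    subst hσ
    nlinarith
  have s3 : b*(2*θ*w - σ/2*J) ≤ 0 := by
    refine mul_nonpos_of_nonneg_of_nonpos hb ?_
    nlinarith [mul_le_mul_of_nonneg_left hw hθ, mul_le_mul_of_nonneg_right hθ₂ hJ]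
  have s4 : θ*q*u^2 ≤ α*(3*η/L^2)*u^2 :=
    mul_le_mul_of_nonneg_right ((mul_le_mul_of_nonneg_left hq₂ hθ).trans hθ₁) (sq_nonneg _)
  linear_combination q*u*hpde + s1 + s2 + s3 + s4


theorem Coeff.abs_bound {b : ℝ → ℝ → ℝ} (hb : Coeff b) : ∃ C, ∀ p : ℝ × ℝ, |b p.1 p.2| ≤ C := by
  obtain ⟨-, h0, M, hM⟩ := hb
  exact ⟨M, fun p => by rw [abs_of_nonneg (h0 _ _)]; exact hM _ _⟩

theorem continuous_memory {F : ℝ × ℝ × ℝ → ℝ} (hF : Continuous F) (h : ℝ) :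
    Continuous (fun q : (ℝ × ℝ) × ℝ => ∫ ρ in (0:ℝ)..1, F (q.1.1, q.1.2, q.2 - ρ*h) ^ 2) :=
  intervalIntegral.continuous_parametric_intervalIntegral_of_continuous' (by fun_prop) _ _

theorem continuous_weighted_memory {F : ℝ × ℝ × ℝ → ℝ} (hF : Continuous F) (h ξ σ : ℝ) :
    Continuous (fun q : (ℝ × ℝ) × ℝ =>
      ∫ ρ in (0:ℝ)..1, h/2*(ξ + σ*(1 - ρ)) * F (q.1.1, q.1.2, q.2 - ρ*h) ^ 2) :=
  intervalIntegral.continuous_parametric_intervalIntegral_of_continuous' (by fun_prop) _ _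

/-- The energy as an integral over the square. -/
theorem pertE_eq_setIntegral {L h ξ : ℝ} (hL : 0 ≤ L) {b : ℝ → ℝ → ℝ} (hb : Coeff b)
    {ζ : ℝ → ℝ → ℝ → ℝ} (hζ : Smooth3 ζ) (t : ℝ) :
    pertE L h ξ b ζ t =
      (∫ p in Ioo (0:ℝ) L ×ˢ Ioo (0:ℝ) L, 1/2 * ζ p.1 p.2 t ^ 2) +
      ∫ p in Ioo (0:ℝ) L ×ˢ Ioo (0:ℝ) L,
        b p.1 p.2 * (ξ*h/2 * ∫ ρ in (0:ℝ)..1, ζ p.1 p.2 (t - ρ*h) ^ 2) := by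
  obtain ⟨C, hC⟩ := hb.abs_bound
  have hc : Continuous (fun p : ℝ × ℝ × ℝ => ζ p.1 p.2.1 p.2.2) := hζ.continuous
  have c1 : Continuous (fun p : ℝ × ℝ => 1/2 * ζ p.1 p.2 t ^ 2) :=
    ((hc.comp (by fun_prop : Continuous fun p : ℝ × ℝ => (p.1, p.2, t))).pow 2).const_mul _
  have c2 : Continuous (fun p : ℝ × ℝ => ξ*h/2 * ∫ ρ in (0:ℝ)..1, ζ p.1 p.2 (t - ρ*h) ^ 2) :=
    ((continuous_memory hc h).comp (by fun_prop : Continuous fun p : ℝ × ℝ => (p, t))).const_mul _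
  rw [setIntegral_square_eq hL (integrableOn_square c1),
    setIntegral_square_eq hL (integrableOn_square_mul hb.1 hC c2), pertE]
  simp only [intervalIntegral.integral_const_mul, mul_left_comm _ (ξ*h/2)]

/-- The Lyapunov functional: the energy plus weighted perturbations of both of its parts. -/
def lyapunov (L h ξ η σ : ℝ) (b : ℝ → ℝ → ℝ) (ζ : ℝ → ℝ → ℝ → ℝ) (t : ℝ) : ℝ :=
  (∫ p in Ioo (0:ℝ) L ×ˢ Ioo (0:ℝ) L, 1/2 * (1 + 2*η*p.1) * ζ p.1 p.2 t ^ 2) +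
  ∫ p in Ioo (0:ℝ) L ×ˢ Ioo (0:ℝ) L,
    b p.1 p.2 * ∫ ρ in (0:ℝ)..1, h/2*(ξ + σ*(1 - ρ)) * ζ p.1 p.2 (t - ρ*h) ^ 2

/-- The Lyapunov functional is equivalent to the energy. -/
theorem pertE_le_lyapunov_and_le {L h ξ η σ κ : ℝ} (hL : 0 ≤ L) (hh : 0 ≤ h) (hξ : 0 < ξ)
    (hη : 0 ≤ η) (hσ : 0 ≤ σ) (hκ : κ = 1 + max (2*η*L) (σ/ξ)) {b : ℝ → ℝ → ℝ} (hb : Coeff b)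
    {ζ : ℝ → ℝ → ℝ → ℝ} (hζ : Smooth3 ζ) (t : ℝ) :
    pertE L h ξ b ζ t ≤ lyapunov L h ξ η σ b ζ t ∧
    lyapunov L h ξ η σ b ζ t ≤ κ * pertE L h ξ b ζ t := by
  obtain ⟨C, hC⟩ := hb.abs_bound
  have hc : Continuous (fun p : ℝ × ℝ × ℝ => ζ p.1 p.2.1 p.2.2) := hζ.continuous
  have hm : MeasurableSet (Ioo (0:ℝ) L ×ˢ Ioo (0:ℝ) L) := measurableSet_Ioo.prod measurableSet_Ioo
  have c0 : Continuous (fun p : ℝ × ℝ => ζ p.1 p.2 t) :=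
    hc.comp (by fun_prop : Continuous fun p : ℝ × ℝ => (p.1, p.2, t))
  have cs : ∀ p : ℝ × ℝ, Continuous (fun ρ => ζ p.1 p.2 (t - ρ*h)) := fun p =>
    hc.comp (by fun_prop : Continuous fun ρ : ℝ => (p.1, p.2, t - ρ*h))
  have cJ : Continuous (fun p : ℝ × ℝ => ∫ ρ in (0:ℝ)..1, ζ p.1 p.2 (t - ρ*h) ^ 2) :=
    (continuous_memory hc h).comp (by fun_prop : Continuous fun p : ℝ × ℝ => (p, t))
  have cW : Continuous (fun p : ℝ × ℝ =>
      ∫ ρ in (0:ℝ)..1, h/2*(ξ + σ*(1 - ρ)) * ζ p.1 p.2 (t - ρ*h) ^ 2) :=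
    (continuous_weighted_memory hc h ξ σ).comp (by fun_prop : Continuous fun p : ℝ × ℝ => (p, t))
  have i1 := integrableOn_square (L := L) (f := fun p => 1/2 * ζ p.1 p.2 t ^ 2) (by fun_prop)
  have i2 := integrableOn_square (L := L)
    (f := fun p => 1/2 * (1 + 2*η*p.1) * ζ p.1 p.2 t ^ 2) (by fun_prop)
  have i3 := integrableOn_square_mul (L := L) hb.1 hC (cJ.const_mul (ξ*h/2))
  have i4 := integrableOn_square_mul (L := L) hb.1 hC cW
  rw [pertE_eq_setIntegral hL hb hζ, lyapunov]
  constructor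
  · refine add_le_add (setIntegral_mono_on i1 i2 hm fun p hp => ?_)
      (setIntegral_mono_on i3 i4 hm fun p _ =>
        mul_le_mul_of_nonneg_left (memory_bounds hh hσ (cs p)).1 (hb.2.1 _ _))
    refine mul_le_mul_of_nonneg_right ?_ (sq_nonneg _)
    nlinarith [mul_nonneg hη hp.1.1.le]
  · rw [mul_add, ← MeasureTheory.integral_const_mul, ← MeasureTheory.integral_const_mul]
    refine add_le_add (setIntegral_mono_on i2 (i1.const_mul κ) hm fun p hp => ?_)
      (setIntegral_mono_on i4 (i3.const_mul κ) hm fun p _ => ?_)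
    · rw [← mul_assoc]
      refine mul_le_mul_of_nonneg_right ?_ (sq_nonneg _)
      have := le_max_left (2*η*L) (σ/ξ)
      nlinarith [mul_le_mul_of_nonneg_left hp.1.2.le hη]
    · rw [mul_left_comm]
      refine mul_le_mul_of_nonneg_left ((memory_bounds hh hσ (cs p)).2.trans ?_) (hb.2.1 _ _)
      rw [← mul_assoc]
      refine mul_le_mul_of_nonneg_right ?_
        (intervalIntegral.integral_nonneg zero_le_one fun _ _ => sq_nonneg _)
      have hk : 1 + σ/ξ ≤ κ := by rw [hκ]; gcongr; exact le_max_right _ _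
      calc h/2*(ξ+σ) = (1 + σ/ξ)*(ξ*h/2) := by field_simp
        _ ≤ κ*(ξ*h/2) := mul_le_mul_of_nonneg_right hk (by positivity)

/-- Time derivative of the Lyapunov functional. -/
theorem hasDerivAt_lyapunov {L h ξ η σ : ℝ} {b : ℝ → ℝ → ℝ} (hb : Coeff b)
    {ζ : ℝ → ℝ → ℝ → ℝ} (hζ : Smooth3 ζ) (t : ℝ) :
    HasDerivAt (lyapunov L h ξ η σ b ζ)
      ((∫ p in Ioo (0:ℝ) L ×ˢ Ioo (0:ℝ) L, (1 + 2*η*p.1) * ζ p.1 p.2 t * pT ζ p.1 p.2 t) +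
      ∫ p in Ioo (0:ℝ) L ×ˢ Ioo (0:ℝ) L, b p.1 p.2 *
        (1/2*(ξ+σ) * ζ p.1 p.2 t ^ 2 - 1/2*ξ * ζ p.1 p.2 (t - h) ^ 2
          - σ/2 * ∫ ρ in (0:ℝ)..1, ζ p.1 p.2 (t - ρ*h) ^ 2)) t := by
  obtain ⟨C, hC⟩ := hb.abs_bound
  have hc : Continuous (fun p : ℝ × ℝ × ℝ => ζ p.1 p.2.1 p.2.2) := hζ.continuous
  have hc' : Continuous (fun p : ℝ × ℝ × ℝ => pT ζ p.1 p.2.1 p.2.2) := by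
    simp only [pT_eq hζ]
    exact (hζ.dirDeriv (0, 0, 1)).continuous
  have hd : ∀ x y τ, HasDerivAt (ζ x y) (pT ζ x y τ) τ := fun x y τ => by
    rw [pT_eq hζ]; exact hasDerivAt_slice_thd hζ x y τ
  have c0 : Continuous (fun q : (ℝ × ℝ) × ℝ => ζ q.1.1 q.1.2 q.2) :=
    hc.comp (by fun_prop : Continuous fun q : (ℝ × ℝ) × ℝ => (q.1.1, q.1.2, q.2))
  have ch : Continuous (fun q : (ℝ × ℝ) × ℝ => ζ q.1.1 q.1.2 (q.2 - h)) :=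
    hc.comp (by fun_prop : Continuous fun q : (ℝ × ℝ) × ℝ => (q.1.1, q.1.2, q.2 - h))
  have c0' : Continuous (fun q : (ℝ × ℝ) × ℝ => pT ζ q.1.1 q.1.2 q.2) :=
    hc'.comp (by fun_prop : Continuous fun q : (ℝ × ℝ) × ℝ => (q.1.1, q.1.2, q.2))
  have cJ := continuous_memory hc h
  have hK : IsCompact (Icc (0:ℝ) L ×ˢ Icc (0:ℝ) L) := isCompact_Icc.prod isCompact_Icc
  have hm : MeasurableSet (Ioo (0:ℝ) L ×ˢ Ioo (0:ℝ) L) := measurableSet_Ioo.prod measurableSet_Ioo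
  have hsub := prod_mono (Ioo_subset_Icc_self (a := (0:ℝ)) (b := L))
    (Ioo_subset_Icc_self (a := (0:ℝ)) (b := L))
  have d1 := hasDerivAt_setIntegral_weighted (μ := volume) hK hm hsub (c := fun _ => 1)
    measurable_const (C := 1) (by simp)
    (F := fun p τ => 1/2 * (1 + 2*η*p.1) * ζ p.1 p.2 τ ^ 2)
    (F' := fun p τ => (1 + 2*η*p.1) * ζ p.1 p.2 τ * pT ζ p.1 p.2 τ) (by fun_prop) (by fun_prop)
    (fun p τ => (((hd p.1 p.2 τ).pow 2).const_mul (1/2 * (1 + 2*η*p.1))).congr_deriv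
      (by push_cast; ring)) t
  have d2 := hasDerivAt_setIntegral_weighted (μ := volume) hK hm hsub hb.1 hC
    (F := fun p τ => ∫ ρ in (0:ℝ)..1, h/2*(ξ + σ*(1 - ρ)) * ζ p.1 p.2 (τ - ρ*h) ^ 2)
    (F' := fun p τ => 1/2*(ξ+σ) * ζ p.1 p.2 τ ^ 2 - 1/2*ξ * ζ p.1 p.2 (τ - h) ^ 2
      - σ/2 * ∫ ρ in (0:ℝ)..1, ζ p.1 p.2 (τ - ρ*h) ^ 2)
    (continuous_weighted_memory hc h ξ σ) (by fun_prop)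
    (fun p τ => hasDerivAt_memory (hd p.1 p.2)
      (hc'.comp (by fun_prop : Continuous fun s : ℝ => (p.1, p.2, s))) τ) t
  simp only [one_mul] at d1
  exact d1.add d2

/-- The dispersive part of the equation dissipates the weighted energy. -/
theorem dispersion_nonneg {L α γ η : ℝ} (hL : 0 < L) (hα : 0 ≤ α) (hγ : 0 ≤ γ) (hη : 0 ≤ η)
    {ζ : ℝ → ℝ → ℝ → ℝ} (hζ : Smooth3 ζ) (hbc : ZKbc L ζ) {t : ℝ} (ht : 0 < t) :
    ∫ p in Ioo (0:ℝ) L ×ˢ Ioo (0:ℝ) L,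
      (-α * ((1 + 2*η*p.1) * ζ p.1 p.2 t * pX3 ζ p.1 p.2 t - 3*η/L^2 * ζ p.1 p.2 t ^ 2)
        - γ * ((1 + 2*η*p.1) * ζ p.1 p.2 t * pXYY ζ p.1 p.2 t)) ≤ 0 := by
  obtain ⟨hby, hbx⟩ := hbc t ht
  have s1 := hζ.dirDeriv (1, 0, 0)
  have s2 := s1.dirDeriv (1, 0, 0)
  have s3 := s2.dirDeriv (1, 0, 0)
  have hmap : Continuous fun p : ℝ × ℝ => (p.1, p.2, t) := by fun_prop
  have c0 : Continuous (fun p : ℝ × ℝ => ζ p.1 p.2 t) := hζ.continuous.comp hmap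
  have c3 : Continuous (fun p : ℝ × ℝ => pX3 ζ p.1 p.2 t) := by
    simp only [pX3_eq hζ]; exact s3.continuous.comp hmap
  have cm : Continuous (fun p : ℝ × ℝ => pXYY ζ p.1 p.2 t) := by
    simp only [pXYY_eq hζ]
    exact (((hζ.dirDeriv (0, 1, 0)).dirDeriv (0, 1, 0)).dirDeriv (1, 0, 0)).continuous.comp hmap
  have hX : 0 ≤ ∫ p in Ioo (0:ℝ) L ×ˢ Ioo (0:ℝ) L,
      ((1 + 2*η*p.1) * ζ p.1 p.2 t * pX3 ζ p.1 p.2 t - 3*η/L^2 * ζ p.1 p.2 t ^ 2) := by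
    rw [setIntegral_square_eq_fst_slices hL.le (by fun_prop)]
    refine setIntegral_nonneg measurableSet_Ioo fun y hy => ?_
    obtain ⟨e0, eL, eX, -⟩ := hby y hy
    rw [pX_eq hζ] at eX
    simp only [pX3_eq hζ]
    exact weighted_third_deriv_nonneg hL hη (fun x => hasDerivAt_slice_fst hζ x y t)
      (fun x => hasDerivAt_slice_fst s1 x y t) (fun x => hasDerivAt_slice_fst s2 x y t)
      (s3.continuous.comp (by fun_prop : Continuous fun x : ℝ => (x, y, t))) e0 eL eX
  have hXYY : 0 ≤ ∫ p in Ioo (0:ℝ) L ×ˢ Ioo (0:ℝ) L,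
      (1 + 2*η*p.1) * ζ p.1 p.2 t * pXYY ζ p.1 p.2 t := by
    simp only [pXYY_eq hζ]
    exact weighted_mixed_deriv_nonneg hL hη hζ t hbx fun y hy => ⟨(hby y hy).1, (hby y hy).2.1⟩
  rw [MeasureTheory.integral_sub (integrableOn_square (by fun_prop))
    (integrableOn_square (by fun_prop)), MeasureTheory.integral_const_mul,
    MeasureTheory.integral_const_mul]
  linarith [mul_nonneg hα hX, mul_nonneg hγ hXYY]

/-- A function satisfying `V' + 2θV ≤ 0` decays exponentially. -/
theorem le_mul_exp_of_deriv_add_le {V V' : ℝ → ℝ} {θ : ℝ} (hd : ∀ t, HasDerivAt V (V' t) t)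
    (hV : ∀ t > 0, V' t + 2*θ*V t ≤ 0) {t : ℝ} (ht : 0 ≤ t) :
    V t ≤ V 0 * Real.exp (-(2*θ)*t) := by
  have hg : ∀ s, HasDerivAt (fun s => V s * Real.exp (2*θ*s))
      ((V' s + 2*θ*V s) * Real.exp (2*θ*s)) s := fun s =>
    ((hd s).mul (((hasDerivAt_id s).const_mul (2*θ)).exp)).congr_deriv (by simp; ring)
  have hanti : AntitoneOn (fun s => V s * Real.exp (2*θ*s)) (Ici 0) := by
    refine antitoneOn_of_deriv_nonpos (convex_Ici 0)
      (fun s _ => (hg s).continuousAt.continuousWithinAt)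
      (fun s _ => (hg s).differentiableAt.differentiableWithinAt) fun s hs => ?_
    rw [interior_Ici] at hs
    rw [(hg s).deriv]
    exact mul_nonpos_of_nonpos_of_nonneg (hV s hs) (Real.exp_nonneg _)
  have h := hanti self_mem_Ici ht ht
  simp only [mul_zero, Real.exp_zero, mul_one] at h
  rw [neg_mul, Real.exp_neg, ← div_eq_mul_inv, le_div_iff₀ (Real.exp_pos _)]
  exact h

/-- Exponential decay for the perturbed delayed ZK system with
source `f = 0`, with explicit constants. -/
theorem perturbed_explicit_decay
    (L α γ h ξ b₀ η σ κ θ : ℝ) (a b : ℝ → ℝ → ℝ)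
    (hL : 0 < L) (hα : 0 < α) (hγ : 0 < γ) (hh : 0 < h)
    (ha : Coeff a) (hb : Coeff b) (hξ : 1 < ξ)
    (ω : Set (ℝ × ℝ)) (hωopen : IsOpen ω) (hωne : ω.Nonempty)
    (hωsub : ω ⊆ Ioo (0:ℝ) L ×ˢ Ioo (0:ℝ) L)
    (hb₀ : 0 < b₀) (hbω : ∀ p ∈ ω, b₀ ≤ b (Prod.fst p) (Prod.snd p))
    (hη₁ : 0 < η) (hη₂ : η < (ξ-1)/(2*L*(1+2*ξ)))
    (hσ : σ = ξ - 1 - 2*L*η*(1+2*ξ))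
    (hκ : κ = 1 + max (2*η*L) (σ/ξ))
    (hθ₁ : 0 < θ)
    (hθ₂ : θ < min (3*α*η/((1+2*η*L)*L^2)) (σ/(2*h*(ξ+σ)))) :
    ∀ ζ : ℝ → ℝ → ℝ → ℝ,
      IsPertSol L α γ h ξ a b (fun _ _ _ => 0) ζ →
      ∀ t > (0:ℝ),
        pertE L h ξ b ζ t ≤ κ * pertE L h ξ b ζ 0 * Real.exp (-(2*θ)*t) := by
  intro ζ ⟨hζ, hbc, hpde⟩ t ht
  have hξ₀ : 0 < ξ := by linarith
  have hσ₀ : 0 < σ := by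
    rw [lt_div_iff₀ (by positivity)] at hη₂
    rw [hσ]; linarith
  obtain ⟨hθ₃, hθ₄⟩ := lt_min_iff.1 hθ₂
  have hθx : θ*(1 + 2*η*L) ≤ α*(3*η/L^2) := by
    rw [lt_div_iff₀ (by positivity)] at hθ₃
    rw [← mul_div_assoc, le_div_iff₀ (by positivity)]
    linarith
  have hθh : θ*(h*(ξ+σ)) ≤ σ/2 := by
    rw [lt_div_iff₀ (by positivity)] at hθ₄
    linarith
  obtain ⟨C, hC⟩ := hb.abs_bound
  have hm : MeasurableSet (Ioo (0:ℝ) L ×ˢ Ioo (0:ℝ) L) := measurableSet_Ioo.prod measurableSet_Ioo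
  have hdec : ∀ s > 0,
      ((∫ p in Ioo (0:ℝ) L ×ˢ Ioo (0:ℝ) L, (1 + 2*η*p.1) * ζ p.1 p.2 s * pT ζ p.1 p.2 s) +
      ∫ p in Ioo (0:ℝ) L ×ˢ Ioo (0:ℝ) L, b p.1 p.2 *
        (1/2*(ξ+σ) * ζ p.1 p.2 s ^ 2 - 1/2*ξ * ζ p.1 p.2 (s - h) ^ 2
          - σ/2 * ∫ ρ in (0:ℝ)..1, ζ p.1 p.2 (s - ρ*h) ^ 2)) +
      2*θ*lyapunov L h ξ η σ b ζ s ≤ 0 := by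
    intro s hs
    have hc : Continuous (fun p : ℝ × ℝ × ℝ => ζ p.1 p.2.1 p.2.2) := hζ.continuous
    have hmap : Continuous fun p : ℝ × ℝ => (p.1, p.2, s) := by fun_prop
    have c0 : Continuous (fun p : ℝ × ℝ => ζ p.1 p.2 s) := hc.comp hmap
    have ch : Continuous (fun p : ℝ × ℝ => ζ p.1 p.2 (s - h)) :=
      hc.comp (by fun_prop : Continuous fun p : ℝ × ℝ => (p.1, p.2, s - h))
    have cT : Continuous (fun p : ℝ × ℝ => pT ζ p.1 p.2 s) := by
      simp only [pT_eq hζ]; exact (hζ.dirDeriv (0, 0, 1)).continuous.comp hmap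
    have c3 : Continuous (fun p : ℝ × ℝ => pX3 ζ p.1 p.2 s) := by
      simp only [pX3_eq hζ]
      exact (((hζ.dirDeriv (1, 0, 0)).dirDeriv (1, 0, 0)).dirDeriv (1, 0, 0)).continuous.comp hmap
    have cm : Continuous (fun p : ℝ × ℝ => pXYY ζ p.1 p.2 s) := by
      simp only [pXYY_eq hζ]
      exact (((hζ.dirDeriv (0, 1, 0)).dirDeriv (0, 1, 0)).dirDeriv (1, 0, 0)).continuous.comp hmap
    have hps : Continuous fun p : ℝ × ℝ => (p, s) := by fun_prop
    have cJ : Continuous (fun p : ℝ × ℝ => ∫ ρ in (0:ℝ)..1, ζ p.1 p.2 (s - ρ*h) ^ 2) :=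
      (continuous_memory hc h).comp hps
    have cW : Continuous (fun p : ℝ × ℝ =>
        ∫ ρ in (0:ℝ)..1, h/2*(ξ + σ*(1 - ρ)) * ζ p.1 p.2 (s - ρ*h) ^ 2) :=
      (continuous_weighted_memory hc h ξ σ).comp hps
    have i1 := integrableOn_square (L := L)
      (f := fun p => (1 + 2*η*p.1) * ζ p.1 p.2 s * pT ζ p.1 p.2 s) (by fun_prop)
    have i2 := integrableOn_square_mul (L := L) hb.1 hC
      (f := fun p => 1/2*(ξ+σ) * ζ p.1 p.2 s ^ 2 - 1/2*ξ * ζ p.1 p.2 (s - h) ^ 2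
        - σ/2 * ∫ ρ in (0:ℝ)..1, ζ p.1 p.2 (s - ρ*h) ^ 2) (by fun_prop)
    have i3 := integrableOn_square (L := L)
      (f := fun p => 1/2 * (1 + 2*η*p.1) * ζ p.1 p.2 s ^ 2) (by fun_prop)
    have i4 := integrableOn_square_mul (L := L) hb.1 hC cW
    rw [lyapunov, ← MeasureTheory.integral_add i1 i2, ← MeasureTheory.integral_add i3 i4,
      ← MeasureTheory.integral_const_mul]
    refine (MeasureTheory.integral_add (i1.add i2)
      ((i3.add i4).const_mul (2*θ))).symm.trans_le ?_
    refine le_trans (setIntegral_mono_on ((i1.add i2).add ((i3.add i4).const_mul _))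
      (integrableOn_square (by fun_prop)) hm fun p hp => ?_)
      (dispersion_nonneg hL hα.le hγ.le hη₁.le hζ hbc hs)
    have cs : Continuous (fun ρ => ζ p.1 p.2 (s - ρ*h)) :=
      hc.comp (by fun_prop : Continuous fun ρ : ℝ => (p.1, p.2, s - ρ*h))
    exact lyapunov_density_le (ha.2.1 p.1 p.2) (hb.2.1 p.1 p.2) hξ₀.le hθ₁.le
      (intervalIntegral.integral_nonneg zero_le_one fun _ _ => sq_nonneg _)
      (by positivity) hσ₀.le hσ (by nlinarith [mul_pos hη₁ hp.1.1])
      (by nlinarith [mul_le_mul_of_nonneg_left hp.1.2.le hη₁.le]) hθx hθh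
      (memory_bounds hh.le hσ₀.le cs).2 (hpde p.1 hp.1 p.2 hp.2 s hs)
  have heq := pertE_le_lyapunov_and_le hL.le hh.le hξ₀ hη₁.le hσ₀.le hκ hb hζ
  calc pertE L h ξ b ζ t ≤ lyapunov L h ξ η σ b ζ t := (heq t).1
    _ ≤ lyapunov L h ξ η σ b ζ 0 * Real.exp (-(2*θ)*t) :=
      le_mul_exp_of_deriv_add_le (fun s => hasDerivAt_lyapunov hb hζ s) hdec ht.le
    _ ≤ κ * pertE L h ξ b ζ 0 * Real.exp (-(2*θ)*t) :=
      mul_le_mul_of_nonneg_right (heq 0).2 (Real.exp_nonneg _)
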